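/- Let Σ be a topologically transitive one-sided Markov shift over the countable alphabet ℤ₊ and A : Σ → ℝ a potential of summable variation. Then for every x ∈ Σ: x ∈ Ω(A) if and only if φ_A(x,x) = h_A(x,x) = 0. -/

import Mathlib

open MeasureTheory Filter Set
open scoped ENNReal

namespace CMS

/-- The one-sided Markov shift `Σ` over the countable alphabet `ℕ = ℤ₊`,
determined by the transition matrix `Tr`. -/
abbrev SS (Tr : ℕ → ℕ → Prop) : Type := {x : ℕ → ℕ // ∀ n, Tr (x n) (x (n + 1))}

/-- The left shift map `σ`. -/
def shiftMap (Tr : ℕ → ℕ → Prop) (x : SS Tr) : SS Tr :=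
  ⟨fun n => x.1 (n + 1), fun n => x.2 (n + 1)⟩

open scoped Classical in
/-- The metric `d(x,y) = λ^ℓ`, `ℓ` the first index of disagreement (`0` if `x = y`). -/
noncomputable def sdist (lam : ℝ) {Tr : ℕ → ℕ → Prop} (x y : SS Tr) : ℝ :=
  if h : ∃ n, x.1 n ≠ y.1 n then lam ^ Nat.find h else 0

/-- Birkhoff sum `S_n f`. -/
noncomputable def birk {Tr : ℕ → ℕ → Prop} (f : SS Tr → ℝ) (n : ℕ) (x : SS Tr) : ℝ :=
  ∑ i ∈ Finset.range n, f ((shiftMap Tr)^[i] x)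

/-- `ℓ`-th variation of `f` restricted to a subset `s` (valued in `ℝ≥0∞`). -/
noncomputable def varAtOn (lam : ℝ) {Tr : ℕ → ℕ → Prop} (s : Set (SS Tr))
    (f : SS Tr → ℝ) (ℓ : ℕ) : ℝ≥0∞ :=
  ⨆ (x ∈ s) (y ∈ s) (_ : sdist lam x y ≤ lam ^ ℓ), ENNReal.ofReal (f x - f y)

/-- `ℓ`-th variation `Var_ℓ(f)`. -/
noncomputable def varAt (lam : ℝ) {Tr : ℕ → ℕ → Prop} (f : SS Tr → ℝ) (ℓ : ℕ) : ℝ≥0∞ :=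
  varAtOn lam Set.univ f ℓ

/-- `Var_k^∞(f) = ∑_{ℓ ≥ k} Var_ℓ(f)`. -/
noncomputable def varFrom (lam : ℝ) {Tr : ℕ → ℕ → Prop} (f : SS Tr → ℝ) (k : ℕ) : ℝ≥0∞ :=
  ∑' ℓ : ℕ, varAt lam f (k + ℓ)

/-- `f` has summable variation: `Var_1^∞(f) < ∞`. -/
def SummableVar (lam : ℝ) {Tr : ℕ → ℕ → Prop} (f : SS Tr → ℝ) : Prop :=
  varFrom lam f 1 < ⊤

/-- `f` is locally Hölder continuous: `Var_ℓ(f) ≤ C λ^ℓ` for all `ℓ ≥ 1`. -/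
def LocHolder (lam : ℝ) {Tr : ℕ → ℕ → Prop} (f : SS Tr → ℝ) : Prop :=
  ∃ C : ℝ, 0 < C ∧ ∀ ℓ : ℕ, 1 ≤ ℓ → varAt lam f ℓ ≤ ENNReal.ofReal (C * lam ^ ℓ)

/-- `‖A - B‖_sv = Var_1^∞(A-B) + ‖A-B‖_∞`. -/
noncomputable def svDist (lam : ℝ) {Tr : ℕ → ℕ → Prop} (A B : SS Tr → ℝ) : ℝ≥0∞ :=
  varFrom lam (fun x => A x - B x) 1 + ⨆ x : SS Tr, ENNReal.ofReal |A x - B x|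

/-- `A` is a potential: continuous and bounded from above. -/
def IsPotential {Tr : ℕ → ℕ → Prop} (A : SS Tr → ℝ) : Prop :=
  Continuous A ∧ BddAbove (Set.range A)

/-- Topological transitivity of the shift. -/
def TopTransitive (Tr : ℕ → ℕ → Prop) : Prop :=
  ∀ U V : Set (SS Tr), IsOpen U → IsOpen V → U.Nonempty → V.Nonempty →
    ∃ n : ℕ, ((shiftMap Tr)^[n] '' U ∩ V).Nonempty

/-- The ergodic maximizing constant `β_A`. -/
noncomputable def beta {Tr : ℕ → ℕ → Prop} (A : SS Tr → ℝ) : ℝ :=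
  sSup {r : ℝ | ∃ μ : Measure (SS Tr), IsProbabilityMeasure μ ∧
    μ.map (shiftMap Tr) = μ ∧ r = ∫ x, A x ∂μ}

/-- `μ` is an `A`-maximizing (shift-invariant Borel probability) measure. -/
def Maximizing {Tr : ℕ → ℕ → Prop} (A : SS Tr → ℝ) (μ : Measure (SS Tr)) : Prop :=
  IsProbabilityMeasure μ ∧ μ.map (shiftMap Tr) = μ ∧ ∫ x, A x ∂μ = beta A

/-- Topological support of a measure. -/
def msupport {Tr : ℕ → ℕ → Prop} (μ : Measure (SS Tr)) : Set (SS Tr) :=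
  {x | ∀ U : Set (SS Tr), IsOpen U → x ∈ U → 0 < μ U}

/-- `μ` is the uniform probability measure on a periodic orbit. -/
def PeriodicOrbitMeasure {Tr : ℕ → ℕ → Prop} (μ : Measure (SS Tr)) : Prop :=
  ∃ (y : SS Tr) (p : ℕ), 1 ≤ p ∧ (shiftMap Tr)^[p] y = y ∧
    μ = (p : ℝ≥0∞)⁻¹ • ∑ i ∈ Finset.range p, Measure.dirac ((shiftMap Tr)^[i] y)

/-- `A` is coercive: `lim_{i→∞} sup A|_[i] = -∞`. -/
def Coercive {Tr : ℕ → ℕ → Prop} (A : SS Tr → ℝ) : Prop :=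
  ∀ M : ℝ, ∃ N : ℕ, ∀ i : ℕ, N ≤ i → ∀ x : SS Tr, x.1 0 = i → A x ≤ M

/-- The Aubry set `Ω(A)`. -/
def Aubry (lam : ℝ) {Tr : ℕ → ℕ → Prop} (A : SS Tr → ℝ) : Set (SS Tr) :=
  {x | ∀ ε : ℝ, 0 < ε → ∃ (w : SS Tr) (n : ℕ), 0 < n ∧
    sdist lam x w < ε ∧ sdist lam ((shiftMap Tr)^[n] w) x < ε ∧
    -ε < (n : ℝ) * beta A - birk A n w ∧ (n : ℝ) * beta A - birk A n w < ε}

/-- The auxiliary function `𝔖^k_l(x,y)` at level `γ`. -/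
noncomputable def aux (lam : ℝ) {Tr : ℕ → ℕ → Prop} (A : SS Tr → ℝ) (γ : ℝ)
    (k l : ℕ) (x y : SS Tr) : EReal :=
  ⨅ (n : ℕ) (_ : l ≤ n) (w : SS Tr)
    (_ : sdist lam x w ≤ lam ^ k) (_ : sdist lam ((shiftMap Tr)^[n] w) y ≤ lam ^ k),
    (((n : ℝ) * γ - birk A n w : ℝ) : EReal)

/-- The Mañé potential `φ^γ_A(x,y)`. -/
noncomputable def mane (lam : ℝ) {Tr : ℕ → ℕ → Prop} (A : SS Tr → ℝ) (γ : ℝ)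
    (x y : SS Tr) : EReal :=
  ⨆ k : ℕ, aux lam A γ k 1 x y

/-- The Peierls barrier `h^γ_A(x,y)`. -/
noncomputable def peierls (lam : ℝ) {Tr : ℕ → ℕ → Prop} (A : SS Tr → ℝ) (γ : ℝ)
    (x y : SS Tr) : EReal :=
  ⨆ (k : ℕ) (l : ℕ), aux lam A γ k (l + 1) x y

section

variable {Tr : ℕ → ℕ → Prop}

theorem sdist_le_pow_iff {lam : ℝ} (h0 : 0 < lam) (h1 : lam < 1) (x y : SS Tr) (k : ℕ) :
    sdist lam x y ≤ lam ^ k ↔ ∀ i < k, x.1 i = y.1 i := by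
  classical
  unfold sdist
  split_ifs with h
  · rw [pow_le_pow_iff_right_of_lt_one₀ h0 h1, Nat.le_find_iff]
    simp
  · push Not at h
    simp [h, h0.le]

theorem iterate_shiftMap_apply (n : ℕ) (x : SS Tr) (j : ℕ) :
    ((shiftMap Tr)^[n] x).1 j = x.1 (j + n) := by
  induction n generalizing x with
  | zero => rfl
  | succ n ih =>
    rw [Function.iterate_succ_apply, ih]
    rfl

/-- Tail of the series of variations, starting from `Var_{k+1}`. -/
noncomputable def varTail (lam : ℝ) (A : SS Tr → ℝ) (k : ℕ) : ℝ :=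
  ∑' j : ℕ, (varAt lam A (j + k + 1)).toReal

theorem SummableVar.summable {lam : ℝ} {A : SS Tr → ℝ} (h : SummableVar lam A) :
    Summable fun j => (varAt lam A (j + 1)).toReal := by
  have h' := h.ne
  simp only [varFrom, add_comm 1] at h'
  exact ENNReal.summable_toReal h'

theorem SummableVar.varAt_ne_top {lam : ℝ} {A : SS Tr → ℝ} (h : SummableVar lam A) (j : ℕ) :
    varAt lam A (j + 1) ≠ ⊤ := by
  have h' := h.ne
  simp only [varFrom, add_comm 1] at h'
  exact ENNReal.ne_top_of_tsum_ne_top h' j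

theorem tendsto_varTail {lam : ℝ} {A : SS Tr → ℝ} :
    Tendsto (varTail lam A) atTop (nhds 0) :=
  tendsto_sum_nat_add fun j => (varAt lam A (j + 1)).toReal

theorem SummableVar.sub_le {lam : ℝ} (h0 : 0 < lam) (h1 : lam < 1) {A : SS Tr → ℝ}
    (h : SummableVar lam A) {x y : SS Tr} {m : ℕ} (hxy : ∀ i < m + 1, x.1 i = y.1 i) :
    A x - A y ≤ (varAt lam A (m + 1)).toReal := by
  rw [← ENNReal.ofReal_le_iff_le_toReal (h.varAt_ne_top m)]
  unfold varAt varAtOn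
  exact le_iSup₂_of_le x (mem_univ x) <| le_iSup₂_of_le y (mem_univ y) <|
    le_iSup_of_le ((sdist_le_pow_iff h0 h1 x y (m + 1)).2 hxy) le_rfl

theorem SummableVar.birk_sub_le {lam : ℝ} (h0 : 0 < lam) (h1 : lam < 1) {A : SS Tr → ℝ}
    (h : SummableVar lam A) {x y : SS Tr} {n k : ℕ} (hxy : ∀ i < n + k, x.1 i = y.1 i) :
    birk A n x - birk A n y ≤ varTail lam A k := by
  have hs : Summable fun j => (varAt lam A (j + k + 1)).toReal :=
    (summable_nat_add_iff (f := fun j => (varAt lam A (j + 1)).toReal) k).2 h.summable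
  unfold birk
  rw [← Finset.sum_sub_distrib]
  calc _ ≤ ∑ i ∈ Finset.range n, (varAt lam A (n - 1 - i + k + 1)).toReal := by
        refine Finset.sum_le_sum fun i hi => h.sub_le h0 h1 fun j hj => ?_
        have := Finset.mem_range.1 hi
        rw [iterate_shiftMap_apply, iterate_shiftMap_apply]
        exact hxy _ (by omega)
    _ = ∑ j ∈ Finset.range n, (varAt lam A (j + k + 1)).toReal :=
        Finset.sum_range_reflect (fun j => (varAt lam A (j + k + 1)).toReal) n
    _ ≤ varTail lam A k := hs.sum_le_tsum _ fun _ _ => ENNReal.toReal_nonneg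

/-- A point whose initial word of positive length `k` recurs at time `n` is shadowed
by a periodic point of period `n`. -/
theorem exists_periodic_shadow {w : SS Tr} {n k : ℕ} (hn : 0 < n) (hk : 0 < k)
    (hw : ∀ i < k, w.1 (i + n) = w.1 i) :
    ∃ y : SS Tr, (shiftMap Tr)^[n] y = y ∧ ∀ i < n + k, y.1 i = w.1 i := by
  refine ⟨⟨fun i => w.1 (i % n), fun i => ?_⟩, ?_, ?_⟩
  · have hlt := Nat.mod_lt i hn
    have hT := w.2 (i % n)
    rcases Nat.lt_or_ge (i % n + 1) n with h | h
    · have e : (i + 1) % n = i % n + 1 := by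
        rw [← Nat.mod_add_mod, Nat.mod_eq_of_lt h]
      simpa only [e] using hT
    · have e : i % n + 1 = n := by omega
      have e' : (i + 1) % n = 0 := by
        rw [← Nat.mod_add_mod, e, Nat.mod_self]
      have := hw 0 hk
      rw [zero_add] at this
      rw [e, this] at hT
      simpa only [e'] using hT
  · ext j
    rw [iterate_shiftMap_apply]
    simp
  · intro i
    induction i using Nat.strong_induction_on with
    | _ i ih =>
      intro hi
      rcases Nat.lt_or_ge i n with h | h
      · simp [Nat.mod_eq_of_lt h]
      · have h1 := ih (i - n) (by omega) (by omega)
        have h2 := hw (i - n) (by omega)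
        rw [Nat.sub_add_cancel h] at h2
        rw [h2, ← h1]
        simp [Nat.mod_eq_sub_mod h]

theorem measurable_shiftMap : Measurable (shiftMap Tr) :=
  Measurable.subtype_mk (f := fun (x : SS Tr) n => x.1 (n + 1)) <|
    measurable_pi_lambda _ fun n => (measurable_pi_apply (n + 1)).comp measurable_subtype_coe

theorem bddAbove_integrals {A : SS Tr → ℝ} (hA : BddAbove (range A)) :
    BddAbove {r : ℝ | ∃ μ : Measure (SS Tr), IsProbabilityMeasure μ ∧
      μ.map (shiftMap Tr) = μ ∧ r = ∫ x, A x ∂μ} := by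
  obtain ⟨M, hM⟩ := hA
  refine ⟨max M 0, ?_⟩
  rintro r ⟨μ, hμ, -, rfl⟩
  by_cases hi : Integrable A μ
  · refine le_max_of_le_left ?_
    calc ∫ x, A x ∂μ ≤ ∫ _, M ∂μ :=
          integral_mono hi (integrable_const M) fun x => hM (mem_range_self x)
      _ = M := by simp
  · rw [integral_undef hi]
    exact le_max_right _ _

theorem birk_le_of_periodic {A : SS Tr → ℝ} (hA : BddAbove (range A)) {n : ℕ} (hn : 0 < n)
    {y : SS Tr} (hy : (shiftMap Tr)^[n] y = y) : birk A n y ≤ n * beta A := by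
  set μ : Measure (SS Tr) :=
    (n : ℝ≥0∞)⁻¹ • ∑ i ∈ Finset.range n, Measure.dirac ((shiftMap Tr)^[i] y) with hμ
  have hprob : IsProbabilityMeasure μ := ⟨by
    simp [hμ, ENNReal.inv_mul_cancel (Nat.cast_ne_zero.2 hn.ne') (ENNReal.natCast_ne_top n)]⟩
  have hinv : μ.map (shiftMap Tr) = μ := by
    rw [hμ, Measure.map_smul, ← Measure.mapₗ_apply_of_measurable measurable_shiftMap, map_sum]
    simp only [Measure.mapₗ_apply_of_measurable measurable_shiftMap,
      Measure.map_dirac' measurable_shiftMap, ← Function.iterate_succ_apply']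
    obtain ⟨m, rfl⟩ := Nat.exists_eq_succ_of_ne_zero hn.ne'
    rw [Finset.sum_range_succ, Finset.sum_range_succ', hy]
    rfl
  have hint : ∫ x, A x ∂μ = (n : ℝ)⁻¹ * birk A n y := by
    rw [hμ, integral_smul_measure, integral_finsetSum_measure]
    · simp [birk]
    · intro i _
      exact integrable_dirac (by simp)
  have hle : (n : ℝ)⁻¹ * birk A n y ≤ beta A :=
    hint ▸ le_csSup (bddAbove_integrals hA) ⟨μ, hprob, hinv, rfl⟩
  rwa [inv_mul_le_iff₀ (by positivity)] at hle

theorem birk_mul_of_periodic (A : SS Tr → ℝ) {n : ℕ} {y : SS Tr}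
    (hy : (shiftMap Tr)^[n] y = y) (l : ℕ) : birk A (n * l) y = l * birk A n y := by
  induction l with
  | zero => simp [birk]
  | succ l ih =>
    have hper : (shiftMap Tr)^[n * l] y = y := by
      rw [Function.iterate_mul]
      exact Function.iterate_fixed hy l
    have : birk A (n * l + n) y = birk A (n * l) y + birk A n y := by
      unfold birk
      rw [Finset.sum_range_add]
      congr 1
      refine Finset.sum_congr rfl fun i _ => ?_
      rw [add_comm, Function.iterate_add_apply, hper]
    rw [Nat.mul_succ, this, ih]
    push_cast
    ring

theorem neg_varTail_le {lam : ℝ} (h0 : 0 < lam) (h1 : lam < 1) {A : SS Tr → ℝ}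
    (hA : BddAbove (range A)) (hs : SummableVar lam A) {x w : SS Tr} {n k : ℕ} (hn : 0 < n)
    (hk : 0 < k) (hx : sdist lam x w ≤ lam ^ k)
    (hw : sdist lam ((shiftMap Tr)^[n] w) x ≤ lam ^ k) :
    -varTail lam A k ≤ n * beta A - birk A n w := by
  rw [sdist_le_pow_iff h0 h1] at hx hw
  simp only [iterate_shiftMap_apply] at hw
  obtain ⟨y, hy, hyw⟩ := exists_periodic_shadow hn hk fun i hi => (hw i hi).trans (hx i hi)
  have e1 := hs.birk_sub_le h0 h1 fun i hi => (hyw i hi).symm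
  have e2 := birk_le_of_periodic hA hn hy
  linarith

theorem neg_varTail_le_aux {lam : ℝ} (h0 : 0 < lam) (h1 : lam < 1) {A : SS Tr → ℝ}
    (hA : BddAbove (range A)) (hs : SummableVar lam A) (x : SS Tr) {k : ℕ} (hk : 0 < k) :
    ((-varTail lam A k : ℝ) : EReal) ≤ aux lam A (beta A) k 1 x x :=
  le_iInf₂ fun _ hn => le_iInf₂ fun _ hx => le_iInf fun hw =>
    EReal.coe_le_coe_iff.2 (neg_varTail_le h0 h1 hA hs hn hk hx hw)

theorem mane_self_nonneg {lam : ℝ} (h0 : 0 < lam) (h1 : lam < 1) {A : SS Tr → ℝ}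
    (hA : BddAbove (range A)) (hs : SummableVar lam A) (x : SS Tr) :
    0 ≤ mane lam A (beta A) x x := by
  have ht : Tendsto (fun k => ((-varTail lam A k : ℝ) : EReal)) atTop (nhds ((0 : ℝ) : EReal)) :=
    EReal.tendsto_coe.2 (by simpa using (tendsto_varTail (lam := lam) (A := A)).neg)
  refine le_of_tendsto ht ?_
  filter_upwards [eventually_gt_atTop 0] with k hk
  exact (neg_varTail_le_aux h0 h1 hA hs x hk).trans
    (le_iSup (fun k => aux lam A (beta A) k 1 x x) k)

theorem mane_le_peierls (lam : ℝ) (A : SS Tr → ℝ) (γ : ℝ) (x y : SS Tr) :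
    mane lam A γ x y ≤ peierls lam A γ x y :=
  iSup_mono fun k => le_iSup (fun l => aux lam A γ k (l + 1) x y) 0

theorem aux_self_nonpos {lam : ℝ} (h0 : 0 < lam) (h1 : lam < 1) {A : SS Tr → ℝ}
    (hs : SummableVar lam A) {x : SS Tr} (hx : x ∈ Aubry lam A) (k l : ℕ) :
    aux lam A (beta A) k (l + 1) x x ≤ 0 := by
  refine EReal.le_of_forall_lt_iff_le.1 fun z hz => ?_
  have hz : 0 < z := by exact_mod_cast hz
  have hl : (0 : ℝ) < l + 1 := by positivity
  obtain ⟨K, hKz, hK⟩ := (((tendsto_varTail (lam := lam) (A := A)).eventually_lt_const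
    (show (0 : ℝ) < z / (l + 1) / 2 by positivity)).and (eventually_gt_atTop k)).exists
  obtain ⟨w, n, hn, hxw, hwx, -, hlt⟩ :=
    hx (min (lam ^ K) (z / (l + 1) / 2)) (lt_min (by positivity) (by positivity))
  have hxw := (sdist_le_pow_iff h0 h1 _ _ _).1 (hxw.le.trans (min_le_left _ _))
  have hwx := (sdist_le_pow_iff h0 h1 _ _ _).1 (hwx.le.trans (min_le_left _ _))
  simp only [iterate_shiftMap_apply] at hwx
  obtain ⟨y, hy, hyw⟩ := exists_periodic_shadow hn (Nat.zero_lt_of_lt hK)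
    fun i hi => (hwx i hi).trans (hxw i hi)
  have hper : (shiftMap Tr)^[n * (l + 1)] y = y := by
    rw [Function.iterate_mul]
    exact Function.iterate_fixed hy (l + 1)
  have hxy : ∀ i < k, x.1 i = y.1 i := fun i hi =>
    (hxw i (hi.trans hK)).trans (hyw i (by omega)).symm
  have hsub := hs.birk_sub_le h0 h1 fun i hi => (hyw i hi).symm
  have hcost : n * beta A - birk A n y ≤ z / (l + 1) := by
    have := hlt.trans_le (min_le_right _ _)
    linarith
  unfold aux
  refine iInf₂_le_of_le (n * (l + 1)) (Nat.le_mul_of_pos_left _ hn) <|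
    iInf₂_le_of_le y ((sdist_le_pow_iff h0 h1 _ _ _).2 hxy) <|
    iInf_le_of_le ?_ (EReal.coe_le_coe_iff.2 ?_)
  · rw [hper]
    exact (sdist_le_pow_iff h0 h1 _ _ _).2 fun i hi => (hxy i hi).symm
  · rw [birk_mul_of_periodic A hy]
    rw [le_div_iff₀ hl] at hcost
    push_cast
    linarith

theorem mem_aubry_of_mane_nonpos {lam : ℝ} (h0 : 0 < lam) (h1 : lam < 1) {A : SS Tr → ℝ}
    (hA : BddAbove (range A)) (hs : SummableVar lam A) {x : SS Tr}
    (hx : mane lam A (beta A) x x ≤ 0) : x ∈ Aubry lam A := by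
  intro ε hε
  obtain ⟨k, ⟨hkε, hk⟩, hpow⟩ := ((((tendsto_varTail (lam := lam)
    (A := A)).eventually_lt_const hε).and (eventually_gt_atTop 0)).and
    ((tendsto_pow_atTop_nhds_zero_of_lt_one h0.le h1).eventually_lt_const hε)).exists
  have hlt : aux lam A (beta A) k 1 x x < (ε : EReal) :=
    ((le_iSup (fun k => aux lam A (beta A) k 1 x x) k).trans hx).trans_lt
      (by exact_mod_cast hε)
  simp only [aux, iInf_lt_iff, EReal.coe_lt_coe_iff] at hlt
  obtain ⟨n, hn, w, hxw, hwx, hlt⟩ := hlt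
  have := neg_varTail_le h0 h1 hA hs hn hk hxw hwx
  exact ⟨w, n, hn, hxw.trans_lt hpow, hwx.trans_lt hpow, by linarith, hlt⟩

end

theorem aubry_iff_mane_peierls_zero
    (lam : ℝ) (hlam0 : 0 < lam) (hlam1 : lam < 1)
    (Tr : ℕ → ℕ → Prop) (htr : TopTransitive Tr)
    (A : SS Tr → ℝ) (hA : IsPotential A) (hAsv : SummableVar lam A)
    (x : SS Tr) :
    x ∈ Aubry lam A ↔
      (mane lam A (beta A) x x = (0 : EReal) ∧ peierls lam A (beta A) x x = (0 : EReal)) := by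
  refine ⟨fun hx => ?_, fun h => mem_aubry_of_mane_nonpos hlam0 hlam1 hA.2 hAsv h.1.le⟩
  have hm := mane_self_nonneg hlam0 hlam1 hA.2 hAsv x
  have hmp := mane_le_peierls lam A (beta A) x x
  have hp : peierls lam A (beta A) x x ≤ 0 :=
    iSup₂_le fun k l => aux_self_nonpos hlam0 hlam1 hAsv hx k l
  exact ⟨le_antisymm (hmp.trans hp) hm, le_antisymm hp (hm.trans hmp)⟩

end CMS
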